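/- Let V be a finite-dimensional real inner product space and let ω be a nondegenerate alternating bilinear form on V. Then there exists a linear endomorphism J of V such that J ∘ J = -id, ω(J u, J v) = ω(u, v) for all u, v ∈ V, and the bilinear form (u, v) ↦ ω(u, J v) is symmetric and positive definite (in particular ω(u, J u) > 0 for all u ≠ 0). -/

import Mathlib

open scoped InnerProductSpace

/-- A positive definite symmetric operator on a finite-dimensional real inner product space has
a positive definite symmetric inverse square root, which commutes with everything the operator
commutes with. -/
theorem LinearMap.IsSymmetric.exists_inverse_sqrt {V : Type*} [NormedAddCommGroup V]
    [InnerProductSpace ℝ V] [FiniteDimensional ℝ V] {T : V →ₗ[ℝ] V} (hT : T.IsSymmetric)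
    (hpos : ∀ x, x ≠ 0 → 0 < ⟪T x, x⟫_ℝ) :
    ∃ S : V →ₗ[ℝ] V, S.IsSymmetric ∧ (∀ x, x ≠ 0 → 0 < ⟪S x, x⟫_ℝ) ∧
      (∀ x, S (S (T x)) = x) ∧
      ∀ A : V →ₗ[ℝ] V, (∀ x, A (T x) = T (A x)) → ∀ x, A (S x) = S (A x) := by
  let b := hT.eigenvectorBasis rfl
  let e := hT.eigenvalues rfl
  have hb (i) : T (b i) = e i • b i := hT.apply_eigenvectorBasis rfl i
  have he (i) : 0 < e i := by
    have h := hpos (b i) (b.orthonormal.ne_zero i)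
    simpa [hb, real_inner_smul_left] using h
  let g (i) : ℝ := (√(e i))⁻¹
  have hg (i) : 0 < g i := inv_pos.2 (Real.sqrt_pos.2 (he i))
  let S : V →ₗ[ℝ] V := ∑ i, g i • (innerₛₗ ℝ (b i)).smulRight (b i)
  have hS (x) : S x = ∑ i, (g i * ⟪b i, x⟫_ℝ) • b i := by
    simp [S, LinearMap.sum_apply, smul_smul]
  have hSinner (x y) : ⟪S x, y⟫_ℝ = ∑ i, g i * (⟪b i, x⟫_ℝ * ⟪b i, y⟫_ℝ) := by
    simp [hS, sum_inner, real_inner_smul_left, mul_assoc]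
  have hSeig (j x) (hx : T x = e j • x) : S x = g j • x := by
    rw [hS, ← b.sum_repr' x, Finset.smul_sum]
    refine Finset.sum_congr rfl fun i _ => ?_
    rw [b.sum_repr', smul_smul]
    have h := hT (b i) x
    rw [hb, hx, real_inner_smul_left, real_inner_smul_right] at h
    rcases mul_eq_mul_right_iff.1 h with h | h
    · simp only [g, h]
    · simp [h]
  have hSb (j) : S (b j) = g j • b j := hSeig j (b j) (hb j)
  refine ⟨S, fun x y => ?_, fun x hx => ?_, fun x => ?_, fun A hA x => ?_⟩
  · rw [hSinner, real_inner_comm, hSinner]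
    simp only [mul_comm]
  · rw [hSinner]
    obtain ⟨i, hi⟩ : ∃ i, ⟪b i, x⟫_ℝ ≠ 0 := by
      by_contra! h
      exact hx (by rw [← b.sum_repr' x]; simp [h])
    exact Finset.sum_pos' (fun j _ => mul_nonneg (hg j).le (mul_self_nonneg _))
      ⟨i, Finset.mem_univ i, mul_pos (hg i) (mul_self_pos.2 hi)⟩
  · have h : S ∘ₗ S ∘ₗ T = LinearMap.id := b.toBasis.ext fun i => by
      have hgi : e i * (g i * g i) = 1 := by
        simp only [g]
        rw [← mul_inv, Real.mul_self_sqrt (he i).le, mul_inv_cancel₀ (he i).ne']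
      simp [hb, hSb, smul_smul, mul_assoc, hgi]
    exact LinearMap.congr_fun h x
  · have h : A ∘ₗ S = S ∘ₗ A := b.toBasis.ext fun i => by
      have hAi : S (A (b i)) = g i • A (b i) := hSeig i _ (by rw [← hA, hb, map_smul])
      simp [hSb, hAi]
    exact LinearMap.congr_fun h x

/-- Let `V` be a finite-dimensional real inner product space and `ω` a nondegenerate
alternating bilinear form on `V`. Then there exists a linear endomorphism `J` of `V`
with `J ∘ J = -id`, `ω (J u) (J v) = ω u v`, and such that `(u, v) ↦ ω u (J v)` is
symmetric and positive definite. -/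
theorem compatible_complex_structure_exists
    (V : Type*) [NormedAddCommGroup V] [InnerProductSpace ℝ V] [FiniteDimensional ℝ V]
    (ω : V →ₗ[ℝ] V →ₗ[ℝ] ℝ)
    (halt : ∀ u, ω u u = 0)
    (hnondeg : ∀ u, (∀ v, ω u v = 0) → u = 0) :
    ∃ J : V →ₗ[ℝ] V,
      J ∘ₗ J = -LinearMap.id ∧
      (∀ u v, ω (J u) (J v) = ω u v) ∧
      (∀ u v, ω u (J v) = ω v (J u)) ∧
      (∀ u, u ≠ 0 → 0 < ω u (J u)) := by
  let A : V →ₗ[ℝ] V := (InnerProductSpace.toDual ℝ V).symm.toLinearEquiv.toLinearMap ∘ₗ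
    LinearMap.toContinuousLinearMap.toLinearMap ∘ₗ ω
  have hA (u v) : ⟪A u, v⟫_ℝ = ω u v := by simp [A]
  have hskew (u v) : ω u v = -ω v u := (LinearMap.IsAlt.neg halt v u).symm
  have hAskew (u v) : ⟪A u, v⟫_ℝ = -⟪u, A v⟫_ℝ := by
    rw [hA, real_inner_comm, hA, hskew]
  have hAne (u) (hu : u ≠ 0) : A u ≠ 0 := fun h =>
    hu (hnondeg u fun v => by rw [← hA, h, inner_zero_left])
  let T : V →ₗ[ℝ] V := -(A ∘ₗ A)
  have hT (u) : T u = -A (A u) := rfl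
  have hTinner (u v) : ⟪T u, v⟫_ℝ = ⟪A u, A v⟫_ℝ := by
    rw [hT, inner_neg_left, hAskew, neg_neg]
  have hTsymm : T.IsSymmetric := fun u v => by
    rw [hTinner, ← real_inner_comm, ← real_inner_comm u, hTinner]
  obtain ⟨S, hSsymm, hSpos, hSST, hScomm⟩ := hTsymm.exists_inverse_sqrt fun x hx => by
    rw [hTinner]
    exact real_inner_self_pos.2 (hAne x hx)
  have hAS := hScomm A fun x => by simp [hT]
  have hJJ (u) : A (S (A (S u))) = -u := by
    rw [← hAS, ← neg_eq_iff_eq_neg, ← hT, hScomm T fun _ => rfl, hScomm T fun _ => rfl,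
      hSST]
  have hωJ (u v) : ω u (A (S v)) = ⟪A u, S (A v)⟫_ℝ := by rw [← hA, hAS]
  have hsymm (u v) : ω u (A (S v)) = ω v (A (S u)) := by
    rw [hωJ, hωJ, ← hSsymm, real_inner_comm]
  refine ⟨A ∘ₗ S, LinearMap.ext hJJ, fun u v => ?_, hsymm, fun u hu => ?_⟩
  · simp only [LinearMap.comp_apply]
    rw [hsymm, hJJ, map_neg, ← hskew]
  · simp only [LinearMap.comp_apply]
    rw [hωJ, real_inner_comm]
    exact hSpos _ (hAne u hu)
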